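/- Assume the continuum hypothesis. Fix a null set H ⊆ 2^ω, and suppose there exists a family 𝒫 ⊆ Perf × Perf together with binary relations ≥ₙ on 𝒫 (n ∈ ℕ) such that: (i) if p ≥ₙ q then p ≥ q; (ii) if p ≥_{n+1} q and r ≥_{n+1} p then r ≥ₙ q; (iii) for every sequence (pₙ) in 𝒫 with p_{n+1} ≥_{n+1} pₙ for all n, there exists p_ω ∈ 𝒫 with p_ω ≥ₙ pₙ for all n; (A1) for every p = (p₁,p₂) ∈ 𝒫, n ∈ ℕ and z ∈ 2^ω there exists q = (q₁,q₂) ∈ 𝒫 with q ≥ₙ p such that q₁ ⊆ H + z or q₂ ⊆ H + z; (A2) for every p ∈ 𝒫, n ∈ ℕ, countable X ⊆ 2^ω, i ∈ {1,2}, and perfect set t ⊆ 2^ω with μ(t) > 0, the set {z ∈ 2^ω : ∃ q = (q₁,q₂) ∈ 𝒫, q ≥ₙ p and X ∪ (q_i + ℚ) ⊆ t + ℚ + z} has μ-measure one (its complement is null). Then there exist strongly meager sets X₁, X₂ ⊆ 2^ω such that X₁ ∪ X₂ is not strongly meager. -/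

import Mathlib

open MeasureTheory Set Pointwise
open scoped ENNReal

/-- The Cantor space `2^ω = ℕ → ZMod 2`, with coordinatewise addition mod 2. -/
abbrev Cantor : Type := ℕ → ZMod 2

/-- The Haar probability measure on the Cantor space (equivalently, the product of
uniform measures on `ZMod 2`).  Applied to an arbitrary set it gives the outer measure,
so `μ H = 0` says that `H` has outer measure zero, i.e. `H` is null. -/
noncomputable def μ : Measure Cantor :=
  Measure.addHaarMeasure ⟨⟨Set.univ, isCompact_univ⟩, by simp⟩

/-- A set `X ⊆ 2^ω` is strongly meager if `X + H ≠ 2^ω` for every null set `H`. -/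
def StronglyMeager (X : Set Cantor) : Prop :=
  ∀ H : Set Cantor, μ H = 0 → X + H ≠ Set.univ

/-- The "rationals" of the Cantor space: sequences that are eventually `0`. -/
def Qfin : Set Cantor := {x | {n | x n ≠ 0}.Finite}

/-- Perfect subsets of the Cantor space: nonempty closed sets without isolated points. -/
def Perf : Type := {p : Set Cantor // Perfect p ∧ p.Nonempty}


section Plane
variable {F : Type} [Field F] [Fintype F]

/-- line sums -/
noncomputable def lineSum (g : F × F → ℝ) (a : F) (w : F × F) : ℝ := ∑ x : F, g (w + (x, a * x))

lemma sum_shift (g : F × F → ℝ) (c : F × F) : ∑ w, g (w + c) = ∑ w, g w :=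
  Fintype.sum_equiv (Equiv.addRight c) _ _ (fun _ => rfl)

lemma lineSum_sum (g : F × F → ℝ) (a : F) :
    ∑ w, lineSum g a w = (Fintype.card F : ℝ) * ∑ w, g w := by
  unfold lineSum
  rw [Finset.sum_comm]
  simp [sum_shift]

lemma lineSum_mul (g : F × F → ℝ) (a b : F) :
    ∑ w, lineSum g a w * lineSum g b w =
      ∑ w, g w * ∑ x : F, ∑ y : F, g (w + (y - x, b * y - a * x)) := by
  unfold lineSum
  simp_rw [Finset.sum_mul_sum, Finset.mul_sum]
  rw [Finset.sum_comm]
  conv_rhs => rw [Finset.sum_comm]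
  refine Finset.sum_congr rfl fun x _ => ?_
  rw [← sum_shift (fun w => ∑ y, g w * g (w + (y - x, b * y - a * x))) (x, a * x)]
  refine Finset.sum_congr rfl fun w _ => Finset.sum_congr rfl fun y _ => ?_
  congr 2
  ext <;> simp

lemma lineSum_mul_ne (g : F × F → ℝ) {a b : F} (hab : a ≠ b) :
    ∑ w, lineSum g a w * lineSum g b w = (∑ w, g w) ^ 2 := by
  rw [lineSum_mul, sq, Finset.sum_mul]
  refine Finset.sum_congr rfl fun w _ => ?_
  congr 1
  rw [← Fintype.sum_prod_type' (f := fun x y => g (w + (y - x, b * y - a * x)))]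
  have hba : b - a ≠ 0 := sub_ne_zero.mpr hab.symm
  have hinj : Function.Injective (fun p : F × F => w + (p.2 - p.1, b * p.2 - a * p.1)) := by
    rintro ⟨x, y⟩ ⟨x', y'⟩ h
    simp only [add_right_inj, Prod.mk.injEq] at h
    obtain ⟨h1, h2⟩ := h
    have h3 : (b - a) * (y - y') = 0 := by linear_combination h2 - a * h1
    have h4 : y = y' := by
      rcases mul_eq_zero.mp h3 with h | h
      · exact absurd h hba
      · exact sub_eq_zero.mp h
    have h5 : x = x' := by subst h4; linear_combination -h1
    rw [h4, h5]
  exact Fintype.sum_equiv (Equiv.ofBijective _ (Finite.injective_iff_bijective.mp hinj)) _ _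
    (fun _ => rfl)

lemma lineSum_sq (g : F × F → ℝ) (a : F) :
    ∑ w, lineSum g a w ^ 2 = (Fintype.card F : ℝ) * ∑ w, g w * lineSum g a w := by
  simp_rw [sq]
  rw [lineSum_mul, Finset.mul_sum]
  refine Finset.sum_congr rfl fun w _ => ?_
  have : ∀ x : F, ∑ y : F, g (w + (y - x, a * y - a * x)) = lineSum g a w := by
    intro x
    unfold lineSum
    refine Fintype.sum_equiv (Equiv.subRight x) _ _ (fun y => ?_)
    simp [mul_sub]
  simp [this]; ring

lemma lineSum_dir (g : F × F → ℝ) (hg : ∀ w, 0 ≤ g w) (w : F × F) :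
    ∑ a, lineSum g a w ≤ (Fintype.card F : ℝ) * g w + ∑ w, g w := by
  classical
  unfold lineSum
  rw [Finset.sum_comm]
  have h1 : ∑ w', g w' = ∑ x : F, ∑ b : F, g (w + (x, b)) := by
    rw [← Fintype.sum_prod_type' (f := fun x b => g (w + (x, b)))]
    exact (Fintype.sum_equiv (Equiv.addLeft w) _ _ (fun _ => rfl)).symm
  rw [h1]
  rw [← Finset.add_sum_erase _ _ (Finset.mem_univ (0 : F))]
  have h0 : w + ((0 : F), (0 : F)) = w := add_zero w
  refine add_le_add (by simp [h0]) ?_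
  refine (Finset.sum_le_sum (f := fun x => ∑ a : F, g (w + (x, a * x)))
    (g := fun x => ∑ b : F, g (w + (x, b))) fun x hx => ?_).trans
      (Finset.sum_le_sum_of_subset_of_nonneg (Finset.erase_subset _ _)
        fun _ _ _ => Finset.sum_nonneg fun _ _ => hg _)
  have hx0 : x ≠ 0 := Finset.ne_of_mem_erase hx
  exact le_of_eq (Fintype.sum_equiv (Equiv.mulRight₀ x hx0) _ _ (fun _ => rfl))

lemma plane_variance (g : F × F → ℝ) (hg : ∀ w, g w = 0 ∨ g w = 1) (A : Finset F) :
    ∑ w, (∑ a ∈ A, (lineSum g a w - (∑ w, g w) / Fintype.card F)) ^ 2 ≤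
      (Fintype.card F : ℝ) ^ 2 * ∑ w, g w := by
  classical
  set q : ℝ := (Fintype.card F : ℝ) with hq
  set T := ∑ w, g w with hT
  have hq0 : q ≠ 0 := by simp [hq]
  have hqpos : 0 < q := by positivity
  have hg0 : ∀ w, 0 ≤ g w := fun w => by rcases hg w with h | h <;> simp [h]
  have hgg : ∀ w, g w * g w = g w := fun w => by rcases hg w with h | h <;> simp [h]
  have hcard : (Fintype.card (F × F) : ℝ) = q * q := by simp [hq]
  have key : ∀ a b, ∑ w, (lineSum g a w - T / q) * (lineSum g b w - T / q) =
      ∑ w, lineSum g a w * lineSum g b w - T ^ 2 := by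
    intro a b
    have : ∀ w, (lineSum g a w - T / q) * (lineSum g b w - T / q) =
      lineSum g a w * lineSum g b w - T / q * lineSum g a w - T / q * lineSum g b w
        + (T / q) ^ 2 := fun w => by ring
    simp_rw [this]
    rw [Finset.sum_add_distrib, Finset.sum_sub_distrib, Finset.sum_sub_distrib,
      ← Finset.mul_sum, ← Finset.mul_sum, lineSum_sum, lineSum_sum]
    simp only [Finset.sum_const, Finset.card_univ, nsmul_eq_mul]
    rw [hcard]
    field_simp
    ring
  have e1 : ∑ w, (∑ a ∈ A, (lineSum g a w - T / q)) ^ 2 =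
      ∑ a ∈ A, (∑ w, lineSum g a w ^ 2 - T ^ 2) := by
    simp_rw [sq (∑ a ∈ A, _), Finset.sum_mul_sum]
    rw [Finset.sum_comm]
    refine Finset.sum_congr rfl fun a ha => ?_
    rw [Finset.sum_comm]
    simp_rw [key]
    rw [Finset.sum_eq_single a]
    · simp_rw [sq]
    · intro b _ hb
      rw [lineSum_mul_ne g hb.symm, hT, sub_self]
    · exact fun h => absurd ha h
  rw [e1]
  have e2 : ∑ a ∈ A, (∑ w, lineSum g a w ^ 2 - T ^ 2) ≤
      ∑ a, (∑ w, lineSum g a w ^ 2 - T ^ 2) := by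
    refine Finset.sum_le_sum_of_subset_of_nonneg (Finset.subset_univ _) fun a _ _ => ?_
    have := key a a
    simp_rw [← sq] at this
    rw [← this]
    positivity
  refine e2.trans ?_
  rw [Finset.sum_sub_distrib]
  simp_rw [lineSum_sq]
  rw [← Finset.mul_sum, Finset.sum_comm]
  simp_rw [← Finset.mul_sum]
  have e3 : ∑ w, g w * ∑ a, lineSum g a w ≤ ∑ w, g w * (q * g w + T) :=
    Finset.sum_le_sum fun w _ => mul_le_mul_of_nonneg_left (lineSum_dir g hg0 w) (hg0 w)
  have e4 : ∑ w, g w * (q * g w + T) = q * T + T ^ 2 := by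
    have : ∀ w, g w * (q * g w + T) = q * g w + g w * T := fun w => by
      linear_combination q * hgg w
    simp_rw [this]
    rw [Finset.sum_add_distrib, ← Finset.mul_sum, ← Finset.sum_mul, ← hT]; ring
  rw [e4] at e3
  have := mul_le_mul_of_nonneg_left e3 hqpos.le
  simp only [Finset.sum_const, Finset.card_univ, nsmul_eq_mul, ← hq]
  nlinarith
end Plane

section Mixing
open Classical in
/-- number of indices `i` with `j i + w ∈ E`. -/
noncomputable def cnt {V : Type} [AddCommGroup V] {k : ℕ} (j : Fin k → V)
    (E : Finset V) (w : V) : ℕ := (Finset.univ.filter fun i => j i + w ∈ E).card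

/-- Pseudo-randomness of the family `j`. -/
def Mixing {V : Type} [AddCommGroup V] [Fintype V] {k : ℕ} (j : Fin k → V) (M : ℝ) : Prop :=
  ∀ (E : Finset V) (η : ℝ), 0 < η → (E.card : ℝ) ≤ η / 2 * Fintype.card V →
    ({w : V | η * k < cnt j E w}.ncard : ℝ) * η ^ 2 ≤ M

lemma exists_mixing_plane {F : Type} [Field F] [Fintype F] (A : Finset F) (hA : A.Nonempty) :
    ∃ j : Fin (A.card * Fintype.card F) → F × F,
      Mixing j (4 * ((Fintype.card F : ℝ) / A.card) ^ 2) := by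
  classical
  have hc : Fintype.card (A × F) = A.card * Fintype.card F := by simp
  let e : Fin (A.card * Fintype.card F) ≃ A × F := (Fintype.equivFinOfCardEq hc).symm
  refine ⟨fun i => ((e i).2, (e i).1 * (e i).2), ?_⟩
  intro E η hη hE
  set q : ℝ := (Fintype.card F : ℝ) with hq
  have hq0 : 0 < q := by simp [hq, Fintype.card_pos]
  have hA0 : (0 : ℝ) < A.card := by exact_mod_cast hA.card_pos
  let g : F × F → ℝ := fun w => if w ∈ E then 1 else 0
  have hT : ∑ w, g w = E.card := by simp [g]
  have hcnt : ∀ w, (cnt (fun i => ((e i).2, (e i).1 * (e i).2)) E w : ℝ) =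
      ∑ a ∈ A, lineSum g a w := by
    intro w
    unfold cnt lineSum
    rw [Finset.card_filter]
    push_cast
    rw [Fintype.sum_equiv e _ (fun p : A × F => g (w + (p.2, p.1 * p.2)))]
    · rw [Fintype.sum_prod_type]
      exact Finset.sum_coe_sort A (fun a => ∑ x, g (w + (x, a * x)))
    · intro i
      simp only [g]
      rw [add_comm]
  have hvar := plane_variance g (fun w => by by_cases h : w ∈ E <;> simp [g, h]) A
  rw [hT] at hvar
  set S : Finset (F × F) := Finset.univ.filter fun w => η * ((A.card * Fintype.card F : ℕ) : ℝ) <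
    cnt (fun i => ((e i).2, (e i).1 * (e i).2)) E w with hS
  have hSn : {w : F × F | η * ((A.card * Fintype.card F : ℕ) : ℝ) <
    cnt (fun i => ((e i).2, (e i).1 * (e i).2)) E w}.ncard = S.card := by
    refine Eq.trans ?_ (Set.ncard_coe_finset S)
    simp [hS]
  rw [hSn]
  have hV : (Fintype.card (F × F) : ℝ) = q * q := by simp [hq]
  rw [hV] at hE
  have hEV : (E.card : ℝ) ≤ q * q := by
    rw [← hV]; exact_mod_cast Finset.card_le_univ E
  have hlow : ∀ w ∈ S, (η * A.card * q / 2) ^ 2 ≤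
      (∑ a ∈ A, (lineSum g a w - E.card / q)) ^ 2 := by
    intro w hw
    have hw' := (Finset.mem_filter.mp hw).2
    rw [hcnt] at hw'
    rw [Finset.sum_sub_distrib]
    simp only [Finset.sum_const, nsmul_eq_mul]
    push_cast at hw'
    rw [← hq] at hw'
    have h1 : (E.card : ℝ) / q ≤ η / 2 * q := by
      rw [div_le_iff₀ hq0]; linarith
    have h2 := mul_le_mul_of_nonneg_left h1 hA0.le
    apply pow_le_pow_left₀ (by positivity)
    linarith
  have h3 : (S.card : ℝ) * (η * A.card * q / 2) ^ 2 ≤ q ^ 2 * E.card := by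
    refine le_trans ?_ hvar
    rw [← nsmul_eq_mul]
    refine (Finset.card_nsmul_le_sum S _ _ hlow).trans ?_
    exact Finset.sum_le_sum_of_subset_of_nonneg (Finset.subset_univ _) fun _ _ _ => sq_nonneg _
  have h4 : (S.card : ℝ) * (η * A.card * q / 2) ^ 2 ≤ q ^ 2 * (q * q) :=
    h3.trans (by gcongr)
  have h5 : (S.card : ℝ) * η ^ 2 * (A.card ^ 2 * q ^ 2 / 4) ≤
      (4 * (q / A.card) ^ 2) * (A.card ^ 2 * q ^ 2 / 4) := by
    have : (4 * (q / A.card) ^ 2) * (A.card ^ 2 * q ^ 2 / 4) = q ^ 2 * (q * q) := by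
      field_simp
    rw [this]; linarith
  exact le_of_mul_le_mul_right h5 (by positivity)

lemma Mixing.transfer {V W : Type} [AddCommGroup V] [Fintype V] [AddCommGroup W] [Fintype W]
    (e : V ≃+ W) {k : ℕ} {j : Fin k → V} {M : ℝ} (h : Mixing j M) :
    Mixing (fun i => e (j i)) M := by
  classical
  intro E η hη hE
  have h1 := h (E.map e.symm.toEquiv.toEmbedding) η hη
    (by rw [Finset.card_map, Fintype.card_congr e.toEquiv]; exact hE)
  refine le_trans (le_of_eq ?_) h1
  congr 2
  have : {w : W | η * k < cnt (fun i => e (j i)) E w} =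
      e '' {w : V | η * k < cnt j (E.map e.symm.toEquiv.toEmbedding) w} := by
    ext w
    rw [e.toEquiv.image_eq_preimage_symm (s := _) |> fun h => (by exact h : e '' _ = _)]
    simp only [Set.mem_ofPred_eq, Set.mem_preimage]
    have : cnt (fun i => e (j i)) E w = cnt j (E.map e.symm.toEquiv.toEmbedding) (e.symm w) := by
      unfold cnt
      congr 1
      ext i
      simp [Finset.mem_map_equiv]
    rw [this]; rfl
  rw [this, Set.ncard_image_of_injective _ e.injective]

/-- The finite combinatorial objects used at each level. -/
lemma exists_mixing (n : ℕ) : ∃ (d k : ℕ) (j : Fin k → (Fin d → ZMod 2)) (M : ℝ),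
    0 < d ∧ 0 < k ∧ k * 2 ^ n ≤ 2 ^ d ∧ Mixing j M ∧ M ^ 2 * 2 ^ n ≤ 2 ^ d ∧ 0 ≤ M := by
  classical
  let m := 3 * n + 4
  have : Fact (Nat.Prime 2) := ⟨Nat.prime_two⟩
  let F := GaloisField 2 m
  have : Fintype F := Fintype.ofFinite F
  have hF : Fintype.card F = 2 ^ m := by
    rw [← Nat.card_eq_fintype_card]; exact GaloisField.card 2 m (by simp [m])
  obtain ⟨A, -, hA⟩ := Finset.exists_subset_card_eq (s := (Finset.univ : Finset F))
    (n := 2 ^ (m - n)) (by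
      rw [Finset.card_univ, hF]; exact Nat.pow_le_pow_right (by norm_num) (by omega))
  have hAne : A.Nonempty := by rw [← Finset.card_pos, hA]; positivity
  obtain ⟨j, hj⟩ := exists_mixing_plane A hAne
  have hfr : Module.finrank (ZMod 2) (F × F) = m + m := by
    rw [Module.finrank_prod, GaloisField.finrank 2 (by simp [m])]
  let e : (F × F) ≃ₗ[ZMod 2] (Fin (m + m) → ZMod 2) :=
    (Module.finBasisOfFinrankEq (ZMod 2) (F × F) hfr).equivFun
  refine ⟨m + m, _, _, _, by simp [m], ?_, ?_, hj.transfer e.toAddEquiv, ?_, by positivity⟩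
  · rw [hF, hA]; positivity
  · rw [hF, hA, ← pow_add, ← pow_add]
    exact Nat.pow_le_pow_right (by norm_num) (by omega)
  · rw [hF, hA]
    push_cast
    have : (2 : ℝ) ^ m / 2 ^ (m - n) = 2 ^ n := by
      rw [div_eq_iff (by positivity), ← pow_add]; congr 1; omega
    rw [this]
    have : (4 * ((2 : ℝ) ^ n) ^ 2) ^ 2 * 2 ^ n = 2 ^ (5 * n + 4) := by ring
    rw [this]
    exact pow_le_pow_right₀ (by norm_num) (by omega)
end Mixing


section Good
variable {V : Type} [AddCommGroup V] [Fintype V] {k : ℕ}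

/-- the pair of excluded sets is small and covers no translate of the family in both coordinates -/
def Good (j : Fin k → V) (η : ℝ) (E E' : Finset V) : Prop :=
  (E.card : ℝ) ≤ η / 2 * Fintype.card V ∧ (E'.card : ℝ) ≤ η / 2 * Fintype.card V ∧
    ∀ w, (cnt j E w : ℝ) ≤ η * k ∨ (cnt j E' w : ℝ) ≤ η * k

lemma Good.symm {j : Fin k → V} {η : ℝ} {E E' : Finset V} (h : Good j η E E') :
    Good j η E' E := ⟨h.2.1, h.1, fun w => (h.2.2 w).symm⟩

lemma Good.mono {j : Fin k → V} {η η' : ℝ} {E E' : Finset V} (h : Good j η E E') (hη : η ≤ η') :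
    Good j η' E E' := by
  have h1 : η / 2 * Fintype.card V ≤ η' / 2 * Fintype.card V := by gcongr
  have h2 : η * k ≤ η' * k := by gcongr
  exact ⟨h.1.trans h1, h.2.1.trans h1, fun w => (h.2.2 w).imp (·.trans h2) (·.trans h2)⟩

open Classical in
/-- translate of a finite set -/
noncomputable def shiftSet (D : Finset V) (z : V) : Finset V := Finset.univ.filter fun x => x + z ∈ D

lemma cnt_union_le {V : Type} [AddCommGroup V] {k : ℕ} [DecidableEq V] (j : Fin k → V)
    (E D : Finset V) (w : V) :
    cnt j (E ∪ D) w ≤ cnt j E w + cnt j D w := by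
  classical
  unfold cnt
  refine le_trans (Finset.card_le_card ?_) (Finset.card_union_le _ _)
  intro i hi
  simpa using hi

lemma cnt_shiftSet (j : Fin k → V) (D : Finset V) (z w : V) :
    cnt j (shiftSet D z) w = cnt j D (w + z) := by
  unfold cnt shiftSet
  congr 1
  ext i
  simp [add_assoc]

lemma card_shiftSet (D : Finset V) (z : V) : (shiftSet D z).card = D.card := by
  classical
  have : shiftSet D z = D.map (Equiv.addRight (-z)).toEmbedding := by
    ext x; simp [shiftSet, Finset.mem_map_equiv]
  rw [this, Finset.card_map]

lemma Good.shrink [DecidableEq V] {j : Fin k → V} {η M : ℝ} {E E' D : Finset V} (hM : Mixing j M)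
    (hM0 : 0 ≤ M) (hη : 0 < η)
    (h : Good j η E E') (hD : (D.card : ℝ) ≤ η / 2 * Fintype.card V) :
    ({z | ¬ Good j (2 * η) (E ∪ shiftSet D z) E'}.ncard : ℝ) * η ^ 4 ≤ M ^ 2 := by
  classical
  set B1 : Finset V := Finset.univ.filter fun w => η * k < cnt j E' w with hB1
  set B2 : Finset V := Finset.univ.filter fun w => η * k < cnt j D w with hB2
  have h1 : (B1.card : ℝ) * η ^ 2 ≤ M := by
    have := hM E' η hη h.2.1
    rwa [show {w : V | η * k < cnt j E' w} = (B1 : Set V) by simp [hB1], Set.ncard_coe_finset] at this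
  have h2 : (B2.card : ℝ) * η ^ 2 ≤ M := by
    have := hM D η hη hD
    rwa [show {w : V | η * k < cnt j D w} = (B2 : Set V) by simp [hB2], Set.ncard_coe_finset] at this
  set U : Finset V := B1.biUnion fun w => shiftSet B2 w with hU
  have hUc : U.card ≤ B1.card * B2.card :=
    Finset.card_biUnion_le_card_mul _ _ _ fun w _ => (card_shiftSet B2 w).le
  have hsub : {z | ¬ Good j (2 * η) (E ∪ shiftSet D z) E'} ⊆ (U : Set V) := by
    intro z hz
    by_contra hzU
    apply hz
    refine ⟨?_, ?_, fun w => ?_⟩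
    · have : ((E ∪ shiftSet D z).card : ℝ) ≤ E.card + D.card := by
        rw [← card_shiftSet D z]; exact_mod_cast Finset.card_union_le _ _
      linarith [h.1]
    · have := h.2.1
      have h0 : (0 : ℝ) ≤ E'.card := by positivity
      linarith
    · have hk : (0 : ℝ) ≤ k := by positivity
      by_cases hw : (cnt j E' w : ℝ) ≤ η * k
      · right; nlinarith
      · left
        have hwE : (cnt j E w : ℝ) ≤ η * k := (h.2.2 w).resolve_right hw
        have hzw : (cnt j D (w + z) : ℝ) ≤ η * k := by
          by_contra hc
          apply hzU
          simp only [hU, Finset.coe_biUnion, Set.mem_iUnion, Finset.mem_coe]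
          refine ⟨w, by simpa [hB1] using hw, ?_⟩
          simp only [shiftSet, Finset.mem_filter, Finset.mem_univ, true_and, hB2]
          rw [add_comm]; exact not_le.mp hc
        have hcu : (cnt j (E ∪ shiftSet D z) w : ℝ) ≤ cnt j E w + cnt j D (w + z) := by
          rw [← cnt_shiftSet]; exact_mod_cast cnt_union_le _ _ _ _
        linarith
  have hn : {z | ¬ Good j (2 * η) (E ∪ shiftSet D z) E'}.ncard ≤ B1.card * B2.card := by
    refine le_trans (Set.ncard_le_ncard hsub (Finset.finite_toSet U)) ?_
    rw [Set.ncard_coe_finset]; exact hUc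
  have hn' : ({z | ¬ Good j (2 * η) (E ∪ shiftSet D z) E'}.ncard : ℝ) ≤ B1.card * B2.card := by
    exact_mod_cast hn
  calc _ ≤ ((B1.card : ℝ) * B2.card) * η ^ 4 := by gcongr
    _ = (B1.card * η ^ 2) * (B2.card * η ^ 2) := by ring
    _ ≤ M * M := by gcongr
    _ = M ^ 2 := by ring
end Good

section Conds
open Filter
variable {V : ℕ → Type} [∀ n, AddCommGroup (V n)] [∀ n, Fintype (V n)] {k : ℕ → ℕ}

/-- forcing conditions: pairs of sequences of excluded sets -/
structure Cond (j : ∀ n, Fin (k n) → V n) where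
  E : Bool → ∀ n, Finset (V n)
  ne : ∀ i n, ∃ v, v ∉ E i n
  good : ∀ i, ∀ η : ℝ, 0 < η → ∃ᶠ n in atTop, Good (j n) η (E i n) (E (!i) n)

variable {j : ∀ n, Fin (k n) → V n}

/-- the (mod finite) body of a condition -/
def Cond.body (p : Cond j) (i : Bool) : Set (∀ n, V n) := {x | ∀ᶠ n in atTop, x n ∉ p.E i n}

/-- almost inclusion -/
def Cond.Le (q p : Cond j) : Prop := ∀ i, ∀ᶠ n in atTop, p.E i n ⊆ q.E i n

lemma Cond.Le.refl (p : Cond j) : p.Le p := fun _ => Eventually.of_forall fun _ => subset_rfl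

lemma Cond.Le.trans {p q r : Cond j} (h1 : p.Le q) (h2 : q.Le r) : p.Le r := fun i => by
  filter_upwards [h1 i, h2 i] with n a b using b.trans a

lemma Cond.Le.body {p q : Cond j} (h : q.Le p) (i : Bool) : q.body i ⊆ p.body i := by
  intro x hx
  filter_upwards [h i, (hx : ∀ᶠ n in atTop, x n ∉ q.E i n)] with n a b hc using b (a hc)

lemma Cond.sigma_closed (p : ℕ → Cond j) (hp : ∀ m, (p (m + 1)).Le (p m)) :
    ∃ q : Cond j, ∀ m, q.Le (p m) := by
  have hle : ∀ m m', m ≤ m' → (p m').Le (p m) := by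
    intro m m' h
    induction m', h using Nat.le_induction with
    | base => exact Cond.Le.refl _
    | succ a _ ih => exact (hp a).trans ih
  have hev : ∀ m, ∀ᶠ n in atTop, ∀ n' ≥ n, ∀ m' ≤ m, ∀ i, (p m').E i n' ⊆ (p m).E i n' := by
    intro m
    rw [eventually_forall_ge_atTop]
    have := (Set.finite_Iic m).eventually_all (l := atTop)
      (p := fun m' n' => ∀ i, (p m').E i n' ⊆ (p m).E i n')
    exact this.mpr fun m' hm' => eventually_all.mpr fun i => hle m' m hm' i
  obtain ⟨φ, hφ, hP⟩ := extraction_forall_of_frequently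
    (P := fun m n => Good (j n) (1 / (m + 1 : ℝ)) ((p m).E false n) ((p m).E true n) ∧
      ∀ n' ≥ n, ∀ m' ≤ m, ∀ i, (p m').E i n' ⊆ (p m).E i n')
    (fun m => ((p m).good false _ (by positivity)).and_eventually (hev m))
  let κ : ℕ → ℕ := fun n => Nat.findGreatest (fun m => φ m ≤ n) n
  have hκ1 : ∀ m n, φ m ≤ n → m ≤ κ n ∧ φ (κ n) ≤ n := by
    intro m n h
    exact ⟨Nat.le_findGreatest (hφ.id_le m |>.trans h) h,
      Nat.findGreatest_spec (P := fun m => φ m ≤ n) (hφ.id_le m |>.trans h) h⟩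
  have hκ2 : ∀ m, κ (φ m) = m := by
    intro m
    obtain ⟨a, b⟩ := hκ1 m (φ m) le_rfl
    exact le_antisymm (hφ.le_iff_le.mp b) a
  have hgood : ∀ η : ℝ, 0 < η → ∃ᶠ n in atTop,
      Good (j n) η ((p (κ n)).E false n) ((p (κ n)).E true n) := by
    intro η hη
    rw [frequently_atTop]
    intro a
    obtain ⟨m0, hm0⟩ := exists_nat_one_div_lt hη
    refine ⟨φ (max a m0), (le_max_left a m0).trans (hφ.id_le _), ?_⟩
    rw [hκ2]
    refine (hP (max a m0)).1.mono (le_trans ?_ hm0.le)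
    apply one_div_le_one_div_of_le (by positivity)
    gcongr
    exact le_max_right _ _
  refine ⟨⟨fun i n => (p (κ n)).E i n, fun i n => (p (κ n)).ne i n, ?_⟩, ?_⟩
  · rintro (_ | _) η hη
    · exact hgood η hη
    · exact (hgood η hη).mono fun n h => h.symm
  · intro m i
    filter_upwards [eventually_ge_atTop (φ m)] with n hn
    obtain ⟨a, b⟩ := hκ1 m n hn
    exact (hP (κ n)).2 n b m a i

lemma Cond.meets (hk : ∀ n, 0 < k n) (p : Cond j) (z : ∀ n, V n) :
    ∃ i, ∃ x ∈ p.body i, ∃ᶠ n in atTop, x n - z n ∈ Set.range (j n) := by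
  classical
  have h1 : ∃ᶠ n in atTop, (∃ a, j n a + z n ∉ p.E false n) ∨ (∃ a, j n a + z n ∉ p.E true n) := by
    refine (p.good false (1/2) (by norm_num)).mono fun n hn => ?_
    have aux : ∀ E : Finset (V n), (cnt (j n) E (z n) : ℝ) ≤ 1 / 2 * k n →
        ∃ a, j n a + z n ∉ E := by
      intro E hE
      by_contra! hc
      have : cnt (j n) E (z n) = k n := by
        unfold cnt
        rw [Finset.filter_true_of_mem fun a _ => hc a]; simp
      rw [this] at hE
      have : (0 : ℝ) < k n := by exact_mod_cast hk n
      linarith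
    exact (hn.2.2 (z n)).imp (aux _) (aux _)
  have h2 : ∃ i, ∃ᶠ n in atTop, ∃ a, j n a + z n ∉ p.E i n := by
    rcases frequently_or_distrib.mp h1 with h | h
    · exact ⟨_, h⟩
    · exact ⟨_, h⟩
  obtain ⟨i, hi⟩ := h2
  choose a ha using p.ne i
  refine ⟨i, fun n => if h : ∃ b, j n b + z n ∉ p.E i n then j n h.choose + z n else a n, ?_, ?_⟩
  · refine Eventually.of_forall fun n => ?_
    by_cases h : ∃ b, j n b + z n ∉ p.E i n
    · simp only [h, dif_pos]; exact h.choose_spec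
    · simp only [h, dif_neg, not_false_iff]; exact ha n
  · refine hi.mono fun n h => ?_
    simp only [h, dif_pos]
    exact ⟨h.choose, by simp⟩
end Conds

section Generic
/-- ω₁ dense sets in a σ-closed preorder are met by a chain. -/
lemma exists_generic {Q T : Type} [Nonempty Q] (le : Q → Q → Prop)
    (hrefl : ∀ p, le p p) (htrans : ∀ p q r, le p q → le q r → le p r)
    (hσ : ∀ p : ℕ → Q, (∀ m, le (p (m + 1)) (p m)) → ∃ q, ∀ m, le q (p m))
    (D : T → Set Q) (hD : ∀ t p, ∃ q ∈ D t, le q p)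
    (hT : Cardinal.mk T ≤ Cardinal.aleph 1) :
    ∃ S : Set Q, (∀ p ∈ S, ∀ q ∈ S, le p q ∨ le q p) ∧ ∀ t, ∃ p ∈ S, p ∈ D t := by
  classical
  let Ω := (Cardinal.aleph 1).ord.ToType
  have hΩ : Cardinal.mk Ω = Cardinal.aleph 1 := by simp [Ω]
  have hemb : Nonempty (T ↪ Ω) := by rw [← hΩ] at hT; exact hT
  obtain ⟨e⟩ := hemb
  have hcount : ∀ α : Ω, (Set.Iio α).Countable := by
    intro α
    have h0 : Cardinal.mk (Set.Iio α) < Cardinal.mk Ω :=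
      Cardinal.mk_Iio_lt α (by rw [hΩ]; simp [Ω])
    have h := (h0.trans_eq hΩ).trans_eq Cardinal.succ_aleph0.symm
    rw [Order.lt_succ_iff] at h
    exact Cardinal.le_aleph0_iff_set_countable.mp h
  let D' : Ω → Set Q := fun α => {q | ∀ t, e t = α → q ∈ D t}
  have hD' : ∀ α p, ∃ q ∈ D' α, le q p := by
    intro α p
    by_cases h : ∃ t, e t = α
    · obtain ⟨t, rfl⟩ := h
      obtain ⟨q, hq, hqp⟩ := hD t p
      exact ⟨q, fun t' ht' => by rwa [e.injective ht'], hqp⟩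
    · exact ⟨p, fun t ht => absurd ⟨t, ht⟩ h, hrefl p⟩
  let f : Ω → Q := (wellFounded_lt (α := Ω)).fix fun α ih =>
    if h : ∃ q ∈ D' α, ∀ β (hβ : β < α), le q (ih β hβ) then h.choose else Classical.arbitrary Q
  have hf : ∀ α, f α = if h : ∃ q ∈ D' α, ∀ β, β < α → le q (f β) then h.choose
      else Classical.arbitrary Q := fun α => WellFounded.fix_eq _ _ _
  have main : ∀ α, f α ∈ D' α ∧ ∀ β, β < α → le (f α) (f β) := by
    intro α
    induction α using (wellFounded_lt (α := Ω)).induction with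
    | _ α ih =>
    have hex : ∃ q ∈ D' α, ∀ β, β < α → le q (f β) := by
      have hlb : ∃ p, ∀ β, β < α → le p (f β) := by
        rcases (Set.Iio α).eq_empty_or_nonempty with h | h
        · exact ⟨Classical.arbitrary Q, fun β hβ => by
            have : β ∈ Set.Iio α := hβ
            rw [h] at this; exact absurd this (by simp)⟩
        · obtain ⟨b, hb⟩ := (hcount α).exists_eq_range h
          have hbα : ∀ m, b m < α := fun m => by
            have : b m ∈ Set.Iio α := by rw [hb]; exact ⟨m, rfl⟩
            exact this
          let c : ℕ → Ω := fun m => Nat.rec (b 0) (fun m x => max x (b (m + 1))) m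
          have hc : ∀ m, c (m + 1) = max (c m) (b (m + 1)) := fun m => rfl
          have hcα : ∀ m, c m < α := by
            intro m
            induction m with
            | zero => exact hbα 0
            | succ m ihm => rw [hc]; exact max_lt ihm (hbα _)
          have hbc : ∀ m, b m ≤ c m := by
            intro m
            cases m with
            | zero => exact le_rfl
            | succ m => rw [hc]; exact le_max_right _ _
          have hmono : ∀ β γ, β ≤ γ → γ < α → le (f γ) (f β) := by
            intro β γ h1 h2
            rcases h1.eq_or_lt with rfl | h1
            · exact hrefl _
            · exact (ih γ h2).2 β h1
          obtain ⟨p, hp⟩ := hσ (fun m => f (c m)) fun m =>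
            hmono _ _ (by rw [hc]; exact le_max_left _ _) (hcα (m + 1))
          refine ⟨p, fun β hβ => ?_⟩
          have : β ∈ Set.Iio α := hβ
          rw [hb] at this
          obtain ⟨m, rfl⟩ := this
          exact htrans _ _ _ (hp m) (hmono _ _ (hbc m) (hcα m))
      obtain ⟨p, hp⟩ := hlb
      obtain ⟨q, hq, hqp⟩ := hD' α p
      exact ⟨q, hq, fun β hβ => htrans _ _ _ hqp (hp β hβ)⟩
    rw [hf, dif_pos hex]
    exact hex.choose_spec
  refine ⟨Set.range f, ?_, fun t => ⟨f (e t), ⟨_, rfl⟩, (main (e t)).1 t rfl⟩⟩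
  rintro _ ⟨α, rfl⟩ _ ⟨β, rfl⟩
  rcases lt_trichotomy α β with h | rfl | h
  · exact Or.inr ((main β).2 α h)
  · exact Or.inl (hrefl _)
  · exact Or.inl ((main α).2 β h)
end Generic


section Meas
open Filter
variable {V : ℕ → Type} [∀ n, AddCommGroup (V n)] [∀ n, Fintype (V n)]
  [∀ n, TopologicalSpace (V n)] [∀ n, DiscreteTopology (V n)] [∀ n, MeasurableSpace (V n)]
  [∀ n, BorelSpace (V n)]

/-- a set depending only on the levels below `L` -/
def FinDep {V : ℕ → Type} (L : ℕ) (B : Set (∀ n, V n)) : Prop :=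
  ∀ x y, (∀ n < L, x n = y n) → x ∈ B → y ∈ B

lemma FinDep.measurableSet {V : ℕ → Type} [∀ n, Fintype (V n)]
    [∀ n, TopologicalSpace (V n)] [∀ n, DiscreteTopology (V n)] [∀ n, MeasurableSpace (V n)]
    [∀ n, BorelSpace (V n)] {L : ℕ} {B : Set (∀ n, V n)} (h : FinDep L B) : MeasurableSet B := by
  let r : (∀ n, V n) → (∀ i : Fin L, V i) := fun x i => x i
  have hr : Measurable r := measurable_pi_lambda _ fun i => measurable_pi_apply _
  have : B = r ⁻¹' (r '' B) := by
    ext x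
    constructor
    · exact fun hx => ⟨x, hx, rfl⟩
    · rintro ⟨y, hy, hyx⟩
      exact h y x (fun n hn => congrFun hyx ⟨n, hn⟩) hy
  rw [this]
  exact hr (Set.toFinite _).measurableSet

lemma exists_cover (ν : Measure (∀ n, V n)) [IsProbabilityMeasure ν] {N : Set (∀ n, V n)}
    (hN : ν N = 0) : ∃ (C : ℕ → Set (∀ n, V n)) (L : ℕ → ℕ), (∀ i, FinDep (L i) (C i)) ∧
      ∑' i, ν (C i) ≠ ∞ ∧ ∀ x ∈ N, ∃ᶠ i in atTop, x ∈ C i := by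
  classical
  have hW : ∀ a : ℕ, ∃ W, N ⊆ W ∧ IsOpen W ∧ ν W < (2⁻¹ : ℝ≥0∞) ^ a := by
    intro a
    obtain ⟨W, h1, h2, h3⟩ := N.exists_isOpen_lt_of_lt (μ := ν) ((2⁻¹ : ℝ≥0∞) ^ a)
      (by rw [hN]; exact ENNReal.pow_pos (by simp) a)
    exact ⟨W, h1, h2, h3⟩
  choose W hNW hWo hWm using hW
  let T : ℕ → ℕ → Set (∀ n, V n) := fun a l => {x | ∀ y : ∀ n, V n, (∀ n < l, x n = y n) → y ∈ W a}
  have hTdep : ∀ a l, FinDep l (T a l) := by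
    intro a l x y hxy hx z hz
    exact hx z fun n hn => (hxy n hn).trans (hz n hn)
  have hTW : ∀ a l, T a l ⊆ W a := fun a l x hx => hx x fun _ _ => rfl
  have hTex : ∀ a, ∀ x ∈ W a, ∃ l, x ∈ T a l := by
    intro a x hx
    obtain ⟨I, u, hu, hsub⟩ := isOpen_pi_iff.mp (hWo a) x hx
    refine ⟨I.sup id + 1, fun y hy => hsub fun n hn => ?_⟩
    have : n ≤ I.sup id := Finset.le_sup (f := id) hn
    rw [← hy n (by omega)]
    exact (hu n hn).2
  have hdd : ∀ a l, FinDep l (disjointed (T a) l) := by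
    intro a l x y hxy hx
    rw [disjointed_eq_inter_compl] at hx ⊢
    simp only [mem_inter_iff, mem_iInter, mem_compl_iff] at hx ⊢
    refine ⟨hTdep a l x y hxy hx.1, fun m hm hy => hx.2 m hm ?_⟩
    exact hTdep a m y x (fun n hn => (hxy n (by omega)).symm) hy
  let C : ℕ × ℕ → Set (∀ n, V n) := fun p => disjointed (T p.1) p.2
  let e := Nat.pairEquiv.symm
  refine ⟨fun i => C (e i), fun i => (e i).2, fun i => hdd _ _, ?_, ?_⟩
  · rw [e.tsum_eq (fun p => ν (C p)), ENNReal.tsum_prod']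
    have : ∀ a, ∑' l, ν (C (a, l)) ≤ (2⁻¹ : ℝ≥0∞) ^ a := by
      intro a
      rw [← measure_iUnion (disjoint_disjointed _) (fun l => (hdd a l).measurableSet)]
      rw [iUnion_disjointed]
      exact (measure_mono (iUnion_subset (hTW a))).trans (hWm a).le
    refine ne_top_of_le_ne_top ?_ (ENNReal.tsum_le_tsum this)
    rw [ENNReal.tsum_geometric]
    simp
  · intro x hx
    rw [Nat.frequently_atTop_iff_infinite]
    have hl : ∀ a, ∃ l, x ∈ C (a, l) := by
      intro a
      obtain ⟨l, hl⟩ := hTex a x (hNW a hx)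
      have : x ∈ ⋃ l, disjointed (T a) l := by
        rw [iUnion_disjointed]; exact mem_iUnion.mpr ⟨l, hl⟩
      exact mem_iUnion.mp this
    choose l hl using hl
    refine Set.infinite_of_injective_forall_mem (f := fun a => e.symm (a, l a)) ?_ ?_
    · intro a b hab
      have := e.symm.injective hab
      exact (Prod.mk.inj this).1
    · intro a
      simpa using hl a

open Classical in
/-- size of a one-level section -/
noncomputable def secCount {V : ℕ → Type} [∀ n, AddCommGroup (V n)] [∀ n, Fintype (V n)]
    (m : ℕ) (B : Set (∀ n, V n)) (z : ∀ n, V n) : ℕ :=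
  (Finset.univ.filter fun v : V m => Pi.single m v + z ∈ B).card

lemma lintegral_secCount (ν : Measure (∀ n, V n)) [ν.IsAddLeftInvariant] (m : ℕ)
    {B : Set (∀ n, V n)} (hB : MeasurableSet B) :
    ∫⁻ z, (secCount m B z : ℝ≥0∞) ∂ν = Fintype.card (V m) * ν B := by
  classical
  have h1 : ∀ z, (secCount m B z : ℝ≥0∞) = ∑ v : V m, B.indicator 1 (Pi.single m v + z) := by
    intro z
    unfold secCount
    rw [Finset.card_filter]
    push_cast
    refine Finset.sum_congr rfl fun v _ => ?_
    simp [Set.indicator_apply]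
  simp_rw [h1]
  rw [lintegral_finsetSum']
  · have : ∀ v : V m, ∫⁻ z, B.indicator 1 (Pi.single m v + z) ∂ν = ν B := by
      intro v
      rw [lintegral_add_left_eq_self (fun z => B.indicator 1 z) (Pi.single m v)]
      exact lintegral_indicator_one hB
    simp [this]
  · intro v _
    exact ((measurable_one.indicator hB).comp (measurable_const_add _)).aemeasurable

lemma measure_le_of_secCount (ν : Measure (∀ n, V n)) [IsProbabilityMeasure ν]
    [ν.IsAddLeftInvariant] (m : ℕ)
    {B : Set (∀ n, V n)} (hB : MeasurableSet B) {c : ℝ}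
    (h : ∀ z, (secCount m B z : ℝ) ≤ c * Fintype.card (V m)) : ν B ≤ ENNReal.ofReal c := by
  have h1 := lintegral_secCount ν m hB
  have hV : (0 : ℝ) < Fintype.card (V m) := by exact_mod_cast Fintype.card_pos
  have h2 : ∫⁻ z, (secCount m B z : ℝ≥0∞) ∂ν ≤
      Fintype.card (V m) * ENNReal.ofReal c := by
    calc _ ≤ ∫⁻ z, (Fintype.card (V m) * ENNReal.ofReal c) ∂ν := by
          refine lintegral_mono fun z => ?_
          rw [← ENNReal.ofReal_natCast, ← ENNReal.ofReal_natCast, ← ENNReal.ofReal_mul hV.le]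
          apply ENNReal.ofReal_le_ofReal
          linarith [h z]
      _ = _ := by simp
  rw [h1] at h2
  refine (ENNReal.mul_le_mul_iff_right ?_ ?_).mp h2
  · simp
  · simp

lemma measure_secCount_gt (ν : Measure (∀ n, V n)) [ν.IsAddLeftInvariant] (m : ℕ)
    {B : Set (∀ n, V n)} (hB : MeasurableSet B) {θ κ : ℝ} (hθ : 0 < θ) (hκ : 0 ≤ κ)
    (h : ν B ≤ ENNReal.ofReal (θ * κ)) :
    ν {z | θ * Fintype.card (V m) < secCount m B z} ≤ ENNReal.ofReal κ := by
  have h1 := lintegral_secCount ν m hB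
  have hV : (0 : ℝ) < Fintype.card (V m) := by exact_mod_cast Fintype.card_pos
  have h2 := mul_meas_ge_le_lintegral₀ (μ := ν) (f := fun z => (secCount m B z : ℝ≥0∞)) ?_
    (ENNReal.ofReal (θ * Fintype.card (V m)))
  · rw [h1] at h2
    have h3 : ENNReal.ofReal (θ * Fintype.card (V m)) *
        ν {z | θ * Fintype.card (V m) < secCount m B z} ≤
        ENNReal.ofReal (θ * Fintype.card (V m)) * ENNReal.ofReal κ := by
      refine le_trans ?_ (h2.trans ?_)
      · refine mul_le_mul' le_rfl (measure_mono fun z hz => ?_)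
        change _ ≤ (secCount m B z : ℝ≥0∞)
        rw [← ENNReal.ofReal_natCast]
        exact ENNReal.ofReal_le_ofReal (le_of_lt hz)
      · rw [← ENNReal.ofReal_mul (by positivity)]
        calc _ ≤ ENNReal.ofReal (Fintype.card (V m)) * ENNReal.ofReal (θ * κ) := by
              rw [ENNReal.ofReal_natCast]; gcongr
          _ = _ := by rw [← ENNReal.ofReal_mul hV.le]; congr 1; ring
    refine (ENNReal.mul_le_mul_iff_right ?_ ?_).mp h3
    · simp; positivity
    · simp
  · classical
    have : (fun z => (secCount m B z : ℝ≥0∞)) =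
        fun z => ∑ v : V m, B.indicator 1 (Pi.single m v + z) := by
      funext z
      unfold secCount
      rw [Finset.card_filter]
      push_cast
      refine Finset.sum_congr rfl fun v _ => ?_
      simp [Set.indicator_apply]
    rw [this]
    exact (Finset.measurable_sum _ fun v _ =>
      (measurable_one.indicator hB).comp (measurable_const_add _)).aemeasurable

/-- saturation: forget the levels below `N` -/
def saturate {V : ℕ → Type} (N : ℕ) (U : Set (∀ n, V n)) : Set (∀ n, V n) :=
  {x | ∃ x' ∈ U, ∀ n, N ≤ n → x n = x' n}

lemma subset_saturate {V : ℕ → Type} (N : ℕ) (U : Set (∀ n, V n)) : U ⊆ saturate N U :=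
  fun x hx => ⟨x, hx, fun _ _ => rfl⟩

lemma saturate_dep {V : ℕ → Type} {N L : ℕ} {U : Set (∀ n, V n)} (hU : FinDep L U)
    {x y : ∀ n, V n} (hxy : ∀ n, N ≤ n → n < L → x n = y n) (hx : x ∈ saturate N U) :
    y ∈ saturate N U := by
  obtain ⟨x', hx', h⟩ := hx
  refine ⟨fun n => if n < N then x' n else y n, hU x' _ (fun n hn => ?_) hx', fun n hn => ?_⟩
  · by_cases h1 : n < N
    · simp [h1]
    · simp only [h1, if_false]
      rw [← h n (by omega), hxy n (by omega) hn]
  · simp [not_lt.mpr hn]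

lemma measure_saturate_le (ν : Measure (∀ n, V n)) [ν.IsAddLeftInvariant] (N : ℕ)
    (U : Set (∀ n, V n)) :
    ν (saturate N U) ≤ (Fintype.card (∀ i : Fin N, V i)) * ν U := by
  let ext : (∀ i : Fin N, V i) → (∀ n, V n) := fun y n => if h : n < N then y ⟨n, h⟩ else 0
  have : saturate N U ⊆ ⋃ y : (∀ i : Fin N, V i), (fun x => ext y + x) ⁻¹' U := by
    rintro x ⟨x', hx', h⟩
    refine mem_iUnion.mpr ⟨fun i => x' i - x i, ?_⟩
    have : ext (fun i => x' i - x i) + x = x' := by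
      funext n
      by_cases hn : n < N
      · simp [ext, hn]
      · simp [ext, hn, h n (by omega)]
    simpa [this] using hx'
  refine (measure_mono this).trans ((measure_iUnion_fintype_le _ _).trans ?_)
  simp [measure_preimage_add]
end Meas


section Main
open Filter
variable {V : ℕ → Type} [∀ n, AddCommGroup (V n)] [∀ n, Fintype (V n)]
  [∀ n, TopologicalSpace (V n)] [∀ n, DiscreteTopology (V n)] [∀ n, MeasurableSpace (V n)]
  [∀ n, BorelSpace (V n)] {k : ℕ → ℕ} {j : ∀ n, Fin (k n) → V n}

/-- choice of sparse levels -/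
lemma exists_levels (ν : Measure (∀ n, V n)) (p : Cond j) (i : Bool)
    (C : ℕ → Set (∀ n, V n)) (L : ℕ → ℕ) (hC : ∑' i, ν (C i) ≠ ∞) :
    ∃ a b : ℕ → ℕ, StrictMono a ∧ StrictMono b ∧ (∀ J, ∀ l < b J, L l ≤ a (J + 1)) ∧
      (∀ J, Good (j (a (J + 1))) ((1 / 2 : ℝ) ^ J) (p.E i (a (J + 1))) (p.E (!i) (a (J + 1)))) ∧
      (∀ J, 5 * J ≤ a (J + 1)) ∧
      ∀ J, (Fintype.card (∀ r : Fin (a J + 1), V r)) * ∑' l, ν (C (l + b J)) ≤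
        ENNReal.ofReal ((1 / 2 : ℝ) ^ J / 2 * (1 / 2 : ℝ) ^ J) := by
  have h1 : ∀ n J : ℕ, ∃ l0, ∀ l ≥ l0, (Fintype.card (∀ r : Fin (n + 1), V r)) *
      ∑' r, ν (C (r + l)) ≤ ENNReal.ofReal ((1 / 2 : ℝ) ^ J / 2 * (1 / 2 : ℝ) ^ J) := by
    intro n J
    have ht := ENNReal.tendsto_sum_nat_add (fun l => ν (C l)) hC
    have ht2 := ENNReal.Tendsto.const_mul (a := (Fintype.card (∀ r : Fin (n + 1), V r) : ℝ≥0∞)) ht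
      (Or.inr (ENNReal.natCast_ne_top _))
    rw [mul_zero] at ht2
    exact eventually_atTop.mp (ht2.eventually_le_const (ENNReal.ofReal_pos.mpr (by positivity)))
  choose β hβ using h1
  have h2 : ∀ J n b : ℕ, ∃ n' > n, (∀ l < b, L l ≤ n') ∧
      Good (j n') ((1 / 2 : ℝ) ^ J) (p.E i n') (p.E (!i) n') ∧ 5 * J ≤ n' := by
    intro J n b
    obtain ⟨n', h, hg⟩ := frequently_atTop.mp (p.good i ((1 / 2 : ℝ) ^ J) (by positivity))
      (n + 1 + 5 * J + (Finset.range b).sup L)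
    refine ⟨n', by omega, fun l hl => ?_, hg, by omega⟩
    have : L l ≤ (Finset.range b).sup L := Finset.le_sup (Finset.mem_range.mpr hl)
    omega
  choose α hα1 hα2 hα3 hα4 using h2
  let s : ℕ → ℕ × ℕ := fun J => Nat.rec (0, β 0 0)
    (fun J s => (α J s.1 s.2, max (s.2 + 1) (β (α J s.1 s.2) (J + 1)))) J
  have hs1 : ∀ J, (s (J + 1)).1 = α J (s J).1 (s J).2 := fun J => rfl
  have hs2 : ∀ J, (s (J + 1)).2 = max ((s J).2 + 1) (β (s (J + 1)).1 (J + 1)) := fun J => rfl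
  refine ⟨fun J => (s J).1, fun J => (s J).2, strictMono_nat_of_lt_succ fun J => ?_,
    strictMono_nat_of_lt_succ fun J => ?_, fun J l hl => ?_, fun J => ?_, fun J => ?_, fun J => ?_⟩
  · rw [hs1]; exact hα1 _ _ _
  · rw [hs2]; exact lt_of_lt_of_le (Nat.lt_succ_self _) (le_max_left _ _)
  · exact hα2 J _ _ l hl
  · exact hα3 J _ _
  · exact hα4 J _ _
  · apply hβ
    cases J with
    | zero => exact le_rfl
    | succ J => exact (le_max_right _ _).trans_eq (hs2 J).symm

open Classical in
/-- the set of values at level `m` leading into `U` -/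
noncomputable def secSet {V : ℕ → Type} [∀ n, Fintype (V n)] (m : ℕ) (U : Set (∀ n, V n))
    (y : ∀ n, V n) : Finset (V m) := Finset.univ.filter fun v => Function.update y m v ∈ U

lemma card_secSet {V : ℕ → Type} [∀ n, AddCommGroup (V n)] [∀ n, Fintype (V n)]
    (m : ℕ) (U : Set (∀ n, V n)) (y : ∀ n, V n) :
    (secSet m U y).card = secCount m U y := by
  rw [← card_shiftSet _ (y m)]
  unfold secSet secCount shiftSet
  congr 1
  ext v
  simp only [Finset.mem_filter, Finset.mem_univ, true_and]
  have : Function.update y m (v + y m) = Pi.single m v + y := by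
    funext n
    by_cases h : n = m
    · subst h; simp
    · simp [h]
  rw [this]

lemma secSet_congr {V : ℕ → Type} [∀ n, Fintype (V n)] {m L : ℕ} {U : Set (∀ n, V n)}
    (hU : FinDep L U) {y y' : ∀ n, V n} (h : ∀ n < L, n ≠ m → y n = y' n) :
    secSet m U y = secSet m U y' := by
  unfold secSet
  ext v
  simp only [Finset.mem_filter, Finset.mem_univ, true_and]
  have aux : ∀ n < L, Function.update y m v n = Function.update y' m v n := by
    intro n hn
    by_cases hnm : n = m
    · subst hnm; simp
    · simp [hnm, h n hn hnm]
  exact ⟨hU _ _ aux, hU _ _ fun n hn => (aux n hn).symm⟩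

lemma secCount_eq_zero {V : ℕ → Type} [∀ n, AddCommGroup (V n)] [∀ n, Fintype (V n)]
    {m : ℕ} {B : Set (∀ n, V n)} {z : ∀ n, V n} (h : ∀ v : V m, Pi.single m v + z ∉ B) :
    secCount m B z = 0 := by
  simp [secCount, h]

/-- measure of the bad set at one level -/
lemma measure_bad (ν : Measure (∀ n, V n)) [IsProbabilityMeasure ν] [ν.IsAddLeftInvariant]
    {M : ℝ} (m J L : ℕ) (hmix : Mixing (j m) M) (hM0 : 0 ≤ M)
    (hMV : M ^ 2 * 2 ^ m ≤ Fintype.card (V m)) (E E' : Finset (V m))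
    (hG : Good (j m) ((1 / 2 : ℝ) ^ J) E E') (hJm : 5 * J ≤ m) (hmL : m < L)
    (U : Set (∀ n, V n)) (hU : FinDep L U)
    (hUm : ν U ≤ ENNReal.ofReal ((1 / 2 : ℝ) ^ J / 2 * (1 / 2 : ℝ) ^ J)) (c : ∀ n, V n) :
    ν {z | ¬ Good (j m) (2 * (1 / 2 : ℝ) ^ J)
      (open Classical in E ∪ shiftSet (secSet m U (c + z)) (z m)) E'} ≤
      ENNReal.ofReal (2 * (1 / 2 : ℝ) ^ J) := by
  classical
  set η : ℝ := (1 / 2 : ℝ) ^ J with hη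
  have hη0 : 0 < η := by positivity
  have hV : (0 : ℝ) < Fintype.card (V m) := by exact_mod_cast Fintype.card_pos
  let B1 : Set (∀ n, V n) := {y | η / 2 * Fintype.card (V m) < secCount m U y}
  let B2 : Set (∀ n, V n) := {z | ((secSet m U (c + z)).card : ℝ) ≤ η / 2 * Fintype.card (V m) ∧
    ¬ Good (j m) (2 * η) (E ∪ shiftSet (secSet m U (c + z)) (z m)) E'}
  have hsub : {z | ¬ Good (j m) (2 * η) (E ∪ shiftSet (secSet m U (c + z)) (z m)) E'} ⊆
      (fun z => c + z) ⁻¹' B1 ∪ B2 := by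
    intro z hz
    by_cases h : ((secSet m U (c + z)).card : ℝ) ≤ η / 2 * Fintype.card (V m)
    · exact Or.inr ⟨h, hz⟩
    · left
      rw [card_secSet] at h
      exact not_le.mp h
  have hB1 : ν ((fun z => c + z) ⁻¹' B1) ≤ ENNReal.ofReal η := by
    rw [measure_preimage_add]
    exact measure_secCount_gt ν m hU.measurableSet (by positivity) hη0.le hUm
  have hB2m : FinDep L B2 := by
    intro x y hxy hx
    have h1 : secSet m U (c + x) = secSet m U (c + y) :=
      secSet_congr hU fun n hn _ => by simp [hxy n hn]
    have h2 : x m = y m := hxy m hmL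
    simp only [B2, mem_ofPred_eq] at hx ⊢
    rw [← h1, ← h2]; exact hx
  have hB2 : ν B2 ≤ ENNReal.ofReal η := by
    refine measure_le_of_secCount ν m hB2m.measurableSet fun z => ?_
    set D := secSet m U (c + z) with hD
    have hDv : ∀ v : V m, secSet m U (c + (Pi.single m v + z)) = D := fun v =>
      secSet_congr hU fun n _ hn => by simp [hn]
    by_cases hDc : (D.card : ℝ) ≤ η / 2 * Fintype.card (V m)
    · have hs := Good.shrink hmix hM0 hη0 hG hDc
      have hle : secCount m B2 z ≤
          {u | ¬ Good (j m) (2 * η) (E ∪ shiftSet D u) E'}.ncard := by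
        unfold secCount
        rw [← Set.ncard_coe_finset]
        refine Set.ncard_le_ncard_of_injOn (fun v => v + z m) ?_ ?_ (Set.toFinite _)
        · intro v hv
          simp only [Finset.coe_filter, Finset.mem_univ, true_and, B2, mem_ofPred_eq] at hv
          have := hv.2
          rw [hDv] at this
          simpa using this
        · intro v _ v' _ h
          simpa using h
      have hle' : (secCount m B2 z : ℝ) ≤
          {u | ¬ Good (j m) (2 * η) (E ∪ shiftSet D u) E'}.ncard := by exact_mod_cast hle
      have h4 : (0 : ℝ) < η ^ 4 * 2 ^ m := by positivity
      have h5 : (secCount m B2 z : ℝ) * (η ^ 4 * 2 ^ m) ≤ Fintype.card (V m) := by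
        calc _ ≤ ({u | ¬ Good (j m) (2 * η) (E ∪ shiftSet D u) E'}.ncard : ℝ) * (η ^ 4 * 2 ^ m) := by
              gcongr
          _ = ({u | ¬ Good (j m) (2 * η) (E ∪ shiftSet D u) E'}.ncard : ℝ) * η ^ 4 * 2 ^ m := by ring
          _ ≤ M ^ 2 * 2 ^ m := by gcongr
          _ ≤ _ := hMV
      have h6 : 1 ≤ η * (η ^ 4 * 2 ^ m) := by
        have : η * (η ^ 4 * 2 ^ m) = 2 ^ m / 2 ^ (5 * J) := by
          rw [hη, one_div, inv_pow]; field_simp; ring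
        rw [this, le_div_iff₀ (by positivity), one_mul]
        exact pow_le_pow_right₀ (by norm_num) hJm
      have h7 : (Fintype.card (V m) : ℝ) ≤ η * Fintype.card (V m) * (η ^ 4 * 2 ^ m) := by
        nlinarith
      exact le_of_mul_le_mul_right (h5.trans h7) h4
    · have : secCount m B2 z = 0 := by
        refine secCount_eq_zero fun v hv => ?_
        have := hv.1
        rw [hDv] at this
        exact hDc this
      rw [this]
      simp; positivity
  calc _ ≤ ν ((fun z => c + z) ⁻¹' B1 ∪ B2) := measure_mono hsub
    _ ≤ _ := measure_union_le _ _
    _ ≤ ENNReal.ofReal η + ENNReal.ofReal η := add_le_add hB1 hB2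
    _ = _ := by rw [← ENNReal.ofReal_add hη0.le hη0.le]; congr 1; ring

lemma Cond.avoid (ν : Measure (∀ n, V n)) [IsProbabilityMeasure ν] [ν.IsAddLeftInvariant]
    {M : ℕ → ℝ} (hmix : ∀ n, Mixing (j n) (M n)) (hM0 : ∀ n, 0 ≤ M n)
    (hMV : ∀ n, M n ^ 2 * 2 ^ n ≤ Fintype.card (V n)) (p : Cond j) (i : Bool)
    {N : Set (∀ n, V n)} (hN : ν N = 0) :
    ∀ᵐ z ∂ν, ∃ q : Cond j, q.Le p ∧ ∀ x ∈ q.body i, x + z ∉ N := by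
  classical
  obtain ⟨C, L, hCdep, hCsum, hNC⟩ := exists_cover ν hN
  obtain ⟨a, b, ha, hb, hL, hG, h5, htail⟩ := exists_levels ν p i C L hCsum
  choose c hc using p.ne i
  let U : ℕ → Set (∀ n, V n) := fun J => ⋃ l, ⋃ (_ : l + b J < b (J + 1)), C (l + b J)
  have hUdep : ∀ J, FinDep (a (J + 2)) (U J) := by
    intro J x y hxy hx
    simp only [U, mem_iUnion] at hx ⊢
    obtain ⟨l, hl, hx⟩ := hx
    exact ⟨l, hl, hCdep _ x y (fun n hn => hxy n (lt_of_lt_of_le hn (hL (J + 1) _ hl))) hx⟩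
  have hUm : ∀ J, ν (U J) ≤ ∑' l, ν (C (l + b J)) := fun J =>
    (measure_mono (show U J ⊆ ⋃ l, C (l + b J) from
      iUnion_mono fun l => iUnion_subset fun _ => subset_rfl)).trans
      (measure_iUnion_le _)
  let S : ℕ → Set (∀ n, V n) := fun J => saturate (a J + 1) (U J)
  have hSdep : ∀ J, FinDep (a (J + 2)) (S J) := fun J x y hxy hx =>
    saturate_dep (hUdep J) (fun n _ hn => hxy n hn) hx
  have hSm : ∀ J, ν (S J) ≤ ENNReal.ofReal ((1 / 2 : ℝ) ^ J / 2 * (1 / 2 : ℝ) ^ J) := fun J =>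
    (measure_saturate_le ν _ _).trans ((mul_le_mul' le_rfl (hUm J)).trans (htail J))
  let Bad : ℕ → Set (∀ n, V n) := fun J => {z | ¬ Good (j (a (J + 1))) (2 * (1 / 2 : ℝ) ^ J)
      (p.E i (a (J + 1)) ∪ shiftSet (secSet (a (J + 1)) (S J) (c + z)) (z (a (J + 1))))
      (p.E (!i) (a (J + 1)))}
  have hBad : ∀ J, ν (Bad J) ≤ ENNReal.ofReal (2 * (1 / 2 : ℝ) ^ J) := fun J =>
    measure_bad ν (a (J + 1)) J (a (J + 2)) (hmix _) (hM0 _) (hMV _) _ _ (hG J) (h5 J)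
      (ha (by omega)) (S J) (hSdep J) (hSm J) c
  have hsum : ∑' J, ν (Bad J) ≠ ∞ := by
    refine ne_top_of_le_ne_top ?_ (ENNReal.tsum_le_tsum hBad)
    have hs : Summable fun J : ℕ => 2 * (1 / 2 : ℝ) ^ J := summable_geometric_two.mul_left 2
    rw [← ENNReal.ofReal_tsum_of_nonneg (fun J => by positivity) hs]
    exact ENNReal.ofReal_ne_top
  filter_upwards [ae_eventually_notMem hsum] with z hz
  obtain ⟨J0, hJ0⟩ := eventually_atTop.mp hz
  let Act : ℕ → ℕ → Prop := fun n J => J0 ≤ J ∧ 1 ≤ J ∧ n = a (J + 1)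
  let Q : ∀ n, Finset (V n) := fun n => if h : ∃ J, Act n J then
    p.E i n ∪ shiftSet (secSet n (S h.choose) (c + z)) (z n) else {c n}ᶜ
  have hQact : ∀ J, J0 ≤ J → 1 ≤ J → Q (a (J + 1)) = p.E i (a (J + 1)) ∪
      shiftSet (secSet (a (J + 1)) (S J) (c + z)) (z (a (J + 1))) := by
    intro J h1 h2
    have h : ∃ J', Act (a (J + 1)) J' := ⟨J, h1, h2, rfl⟩
    have : h.choose = J := by
      have := ha.injective h.choose_spec.2.2
      omega
    simp only [Q, dif_pos h]
    rw [this]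
  have hQgood : ∀ J, J0 ≤ J → 1 ≤ J → Good (j (a (J + 1))) (2 * (1 / 2 : ℝ) ^ J)
      (Q (a (J + 1))) (p.E (!i) (a (J + 1))) := by
    intro J h1 h2
    rw [hQact J h1 h2]
    exact not_not.mp (hJ0 J h1)
  have hQfreq : ∀ η : ℝ, 0 < η → ∃ᶠ n in atTop, Good (j n) η (Q n) (p.E (!i) n) := by
    intro η hη
    rw [frequently_atTop]
    intro r
    obtain ⟨J1, hJ1⟩ := exists_pow_lt_of_lt_one (show (0 : ℝ) < η / 2 by positivity)
      (show (1 / 2 : ℝ) < 1 by norm_num)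
    set J := r + J0 + J1 + 1
    refine ⟨a (J + 1), ?_, (hQgood J (by omega) (by omega)).mono ?_⟩
    · have := ha.id_le (J + 1)
      simp only [id] at this
      omega
    · have : (1 / 2 : ℝ) ^ J ≤ (1 / 2) ^ J1 :=
        pow_le_pow_of_le_one (by norm_num) (by norm_num) (by omega)
      linarith
  have hQne : ∀ n, ∃ v, v ∉ Q n := by
    intro n
    by_cases h : ∃ J, Act n J
    · obtain ⟨J, h1, h2, rfl⟩ := h
      have hg := (hQgood J h1 h2).1
      by_contra! hcon
      have hu : Q (a (J + 1)) = Finset.univ := Finset.eq_univ_iff_forall.mpr hcon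
      rw [hu, Finset.card_univ] at hg
      have hV : (0 : ℝ) < Fintype.card (V (a (J + 1))) := by exact_mod_cast Fintype.card_pos
      have : (1 / 2 : ℝ) ^ J ≤ (1 / 2) ^ 1 :=
        pow_le_pow_of_le_one (by norm_num) (by norm_num) h2
      nlinarith
    · exact ⟨c n, by simp [Q, dif_neg h]⟩
  have hQsub : ∀ n, p.E i n ⊆ Q n := by
    intro n
    by_cases h : ∃ J, Act n J
    · simp only [Q, dif_pos h]; exact Finset.subset_union_left
    · simp only [Q, dif_neg h]
      intro v hv
      simp only [Finset.mem_compl, Finset.mem_singleton]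
      rintro rfl
      exact hc n hv
  let q : Cond j :=
    { E := fun i' n => if i' = i then Q n else p.E i' n
      ne := by
        intro i' n
        by_cases h : i' = i
        · simp only [h, if_true]; exact hQne n
        · simp only [h, if_false]; exact p.ne i' n
      good := by
        intro i' η hη
        by_cases h : i' = i
        · subst h
          simpa using hQfreq η hη
        · have h' : i' = !i := by cases i <;> cases i' <;> simp_all
          subst h'
          simpa using (hQfreq η hη).mono fun n h => h.symm }
  refine ⟨q, fun i' => Eventually.of_forall fun n => ?_, ?_⟩
  · by_cases h : i' = i
    · simp only [q, h, if_true]; exact hQsub n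
    · simp only [q, h, if_false]; exact subset_rfl
  · intro x hx hxN
    have hx' : ∀ᶠ n in atTop, x n ∉ Q n := by simpa [Cond.body, q] using hx
    obtain ⟨n0, hn0⟩ := eventually_atTop.mp hx'
    have hnot : ∀ J, J0 + 1 + n0 ≤ J → x + z ∉ S J := by
      intro J hJ hxS
      have haJ : J ≤ a J := ha.id_le J
      have haJ1 : a J < a (J + 1) := ha (by omega)
      have h1 := hn0 (a (J + 1)) (by omega)
      rw [hQact J (by omega) (by omega)] at h1
      apply h1
      apply Finset.mem_union_right
      simp only [shiftSet, secSet, Finset.mem_filter, Finset.mem_univ, true_and]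
      refine saturate_dep (hUdep J) (fun n hn1 hn2 => ?_) hxS
      by_cases hnm : n = a (J + 1)
      · subst hnm; simp
      · have hna : ¬ ∃ J', Act n J' := by
          rintro ⟨J', -, -, rfl⟩
          have e1 : J < J' + 1 := ha.lt_iff_lt.mp (by omega)
          have e2 : J' + 1 < J + 2 := ha.lt_iff_lt.mp hn2
          exact hnm (by congr 1; omega)
        have := hn0 n (by omega)
        simp only [Q, dif_neg hna, Finset.mem_compl, Finset.mem_singleton, not_not] at this
        simp [hnm, this]
    obtain ⟨l, hl, hlC⟩ := frequently_atTop.mp (hNC _ hxN) (b (J0 + 1 + n0))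
    have hex : ∃ J, l < b J := ⟨l + 1, lt_of_lt_of_le (Nat.lt_succ_self l) (hb.id_le _)⟩
    have hfind := Nat.find_spec hex
    have hpos : J0 + 1 + n0 < Nat.find hex := by
      by_contra hcon
      have := hb.monotone (not_lt.mp hcon)
      omega
    obtain ⟨J, hJ⟩ : ∃ J, Nat.find hex = J + 1 := ⟨Nat.find hex - 1, by omega⟩
    have hbJ : b J ≤ l := not_lt.mp (Nat.find_min hex (by omega))
    rw [hJ] at hfind
    apply hnot J (by omega)
    apply subset_saturate
    simp only [U, mem_iUnion]
    exact ⟨l - b J, by omega, by rwa [Nat.sub_add_cancel hbJ]⟩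
end Main


section Assembly
open Filter
variable {V : ℕ → Type} [∀ n, AddCommGroup (V n)] [∀ n, Fintype (V n)]
  {k : ℕ → ℕ}

/-- conditions with countable working parts -/
structure WCond (j : ∀ n, Fin (k n) → V n) where
  c : Cond j
  X : Bool → Set (∀ n, V n)
  hX : ∀ i, (X i).Countable

variable {j : ∀ n, Fin (k n) → V n}

/-- order on the conditions with working parts -/
def WCond.Le (q p : WCond j) : Prop :=
  q.c.Le p.c ∧ ∀ i, p.X i ⊆ q.X i ∧ q.X i ⊆ p.X i ∪ p.c.body i

lemma WCond.Le.refl (p : WCond j) : p.Le p :=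
  ⟨Cond.Le.refl _, fun _ => ⟨subset_rfl, subset_union_left⟩⟩

lemma WCond.Le.trans {p q r : WCond j} (h1 : p.Le q) (h2 : q.Le r) : p.Le r :=
  ⟨h1.1.trans h2.1, fun i => ⟨(h2.2 i).1.trans (h1.2 i).1, (h1.2 i).2.trans
    (union_subset (h2.2 i).2 ((h2.1.body i).trans subset_union_right))⟩⟩

lemma WCond.sigma_closed (p : ℕ → WCond j) (hp : ∀ m, (p (m + 1)).Le (p m)) :
    ∃ q : WCond j, ∀ m, q.Le (p m) := by
  have hmono : ∀ m r, (p (m + r)).Le (p m) := by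
    intro m r
    induction r with
    | zero => exact WCond.Le.refl _
    | succ r ih => exact (hp (m + r)).trans ih
  obtain ⟨c, hc⟩ := Cond.sigma_closed (fun m => (p m).c) (fun m => (hp m).1)
  refine ⟨⟨c, fun i => ⋃ m, (p m).X i, fun i => countable_iUnion fun m => (p m).hX i⟩, fun m =>
    ⟨hc m, fun i => ⟨subset_iUnion (fun m => (p m).X i) m, iUnion_subset fun m' => ?_⟩⟩⟩
  rcases le_total m m' with h | h
  · obtain ⟨r, rfl⟩ := Nat.exists_eq_add_of_le h
    exact ((hmono m r).2 i).2
  · obtain ⟨r, rfl⟩ := Nat.exists_eq_add_of_le h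
    exact ((hmono m' r).2 i).1.trans subset_union_left

/-- the trivial condition -/
def WCond.triv (j : ∀ n, Fin (k n) → V n) : WCond j where
  c :=
    { E := fun _ _ => ∅
      ne := fun _ _ => ⟨0, by simp⟩
      good := fun i η hη => Frequently.of_forall fun n => by
        have := hη.le
        refine ⟨by simp; positivity, by simp; positivity, fun w => Or.inl ?_⟩
        simp [cnt]; positivity }
  X := fun _ => ∅
  hX := fun _ => countable_empty

variable [∀ n, TopologicalSpace (V n)] [∀ n, DiscreteTopology (V n)] [∀ n, MeasurableSpace (V n)]
  [∀ n, BorelSpace (V n)]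

lemma exists_sets (CH : Cardinal.continuum.{0} = Cardinal.aleph 1)
    (ν : Measure (∀ n, V n)) [IsProbabilityMeasure ν] [ν.IsAddLeftInvariant]
    (hk : ∀ n, 0 < k n)
    {M : ℕ → ℝ} (hmix : ∀ n, Mixing (j n) (M n)) (hM0 : ∀ n, 0 ≤ M n)
    (hMV : ∀ n, M n ^ 2 * 2 ^ n ≤ Fintype.card (V n)) :
    ∃ Y : Bool → Set (∀ n, V n), (∀ i, ∀ G, ν G = 0 → ∃ u, ∀ x ∈ Y i, x + u ∉ G) ∧
      ∀ z : ∀ n, V n, ∃ i, ∃ x ∈ Y i, ∃ᶠ n in atTop, x n - z n ∈ range (j n) := by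
  classical
  let T := (∀ n, V n) ⊕ ({G : Set (∀ n, V n) // MeasurableSet G ∧ ν G = 0} × Bool)
  let D : T → Set (WCond j) := fun t => match t with
    | Sum.inl z => {q | ∃ i, ∃ x ∈ q.X i, ∃ᶠ n in atTop, x n - z n ∈ range (j n)}
    | Sum.inr (G, i) => {q | ∃ u, ∀ x ∈ q.X i ∪ q.c.body i, x + u ∉ G.1}
  obtain ⟨bs, hbs, hbs2⟩ := MeasurableSpace.CountablyGenerated.isCountablyGenerated (α := ∀ n, V n)
  have hm : Cardinal.mk {G : Set (∀ n, V n) // MeasurableSet G} ≤ Cardinal.continuum := by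
    rw [hbs2]
    exact MeasurableSpace.cardinal_measurableSet_le_continuum
      (hbs.le_aleph0.trans Cardinal.aleph0_le_continuum)
  have hT : Cardinal.mk T ≤ Cardinal.aleph 1 := by
    rw [← CH]
    have h1 : Cardinal.mk (∀ n, V n) ≤ Cardinal.continuum := by
      refine le_trans ?_ hm
      refine Cardinal.mk_le_of_injective
        (f := fun x => (⟨{x}, measurableSet_singleton x⟩ : {G : Set (∀ n, V n) // MeasurableSet G})) ?_
      intro x y hxy
      exact singleton_injective (Subtype.ext_iff.mp hxy)
    have h2 : Cardinal.mk {G : Set (∀ n, V n) // MeasurableSet G ∧ ν G = 0} ≤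
        Cardinal.continuum :=
      le_trans (Cardinal.mk_subtype_mono fun G h => h.1) hm
    simp only [T, Cardinal.mk_sum, Cardinal.lift_id, Cardinal.mk_prod]
    refine (add_le_add h1 (mul_le_mul' h2 
      (Cardinal.mk_le_aleph0.trans Cardinal.aleph0_le_continuum : Cardinal.mk Bool ≤ _))).trans ?_
    simp
  have hD : ∀ t p, ∃ q ∈ D t, WCond.Le q p := by
    rintro (z | ⟨⟨G, hGm, hG⟩, i⟩) p
    · obtain ⟨i, x, hx, hxz⟩ := p.c.meets hk z
      refine ⟨⟨p.c, fun i' => if i' = i then insert x (p.X i') else p.X i', fun i' => ?_⟩,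
        ⟨i, x, by simp, hxz⟩, Cond.Le.refl _, fun i' => ?_⟩
      · by_cases h : i' = i
        · simp only [h, if_true]; exact (p.hX i).insert x
        · simp only [h, if_false]; exact p.hX i'
      · by_cases h : i' = i
        · subst h
          simp only [if_true]
          exact ⟨subset_insert _ _, insert_subset (Or.inr hx) subset_union_left⟩
        · simp only [h, if_false]
          exact ⟨subset_rfl, subset_union_left⟩
    · have h1 := Cond.avoid ν hmix hM0 hMV p.c i hG
      have h2 : ∀ᵐ z ∂ν, ∀ x ∈ p.X i, x + z ∉ G := by
        rw [ae_ball_iff (p.hX i)]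
        intro x _
        rw [ae_iff]
        have : {z | ¬ (x + z ∉ G)} = (fun z => x + z) ⁻¹' G := by ext; simp
        rw [this, measure_preimage_add]; exact hG
      obtain ⟨z, ⟨q, hqp, hq⟩, hz⟩ := (h1.and h2).exists
      refine ⟨⟨q, p.X, p.hX⟩, ⟨z, ?_⟩, hqp, fun i' => ⟨subset_rfl, subset_union_left⟩⟩
      rintro x (hx | hx)
      · exact hz x hx
      · exact hq x hx
  have : Nonempty (WCond j) := ⟨WCond.triv j⟩
  obtain ⟨S, hS, hSD⟩ := exists_generic WCond.Le WCond.Le.refl (fun _ _ _ => WCond.Le.trans)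
    WCond.sigma_closed D hD hT
  refine ⟨fun i => ⋃ p ∈ S, p.X i, ?_, ?_⟩
  · intro i G hG
    obtain ⟨p, hp, u, hu⟩ := hSD (Sum.inr (⟨toMeasurable ν G, measurableSet_toMeasurable _ _,
      by rw [measure_toMeasurable]; exact hG⟩, i))
    refine ⟨u, fun x hx hxG => ?_⟩
    simp only [mem_iUnion] at hx
    obtain ⟨q, hq, hx⟩ := hx
    refine hu x ?_ (subset_toMeasurable ν G hxG)
    rcases hS p hp q hq with h | h
    · exact Or.inl ((h.2 i).1 hx)
    · exact (h.2 i).2 hx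
  · intro z
    obtain ⟨p, hp, i, x, hx, hxz⟩ := hSD (Sum.inl z)
    exact ⟨i, x, by simp only [mem_iUnion]; exact ⟨p, hp, hx⟩, hxz⟩

lemma null_hits (ν : Measure (∀ n, V n)) [IsProbabilityMeasure ν] [ν.IsAddLeftInvariant]
    (hkV : ∀ n, k n * 2 ^ n ≤ Fintype.card (V n)) :
    ν {x | ∃ᶠ n in atTop, x n ∈ range (j n)} = 0 := by
  classical
  apply measure_setOfPred_frequently_eq_zero
  have hb : ∀ n, ν {x | x n ∈ range (j n)} ≤ ENNReal.ofReal ((1 / 2 : ℝ) ^ n) := by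
    intro n
    refine measure_le_of_secCount ν n ?_ fun z => ?_
    · exact (FinDep.measurableSet (L := n + 1) fun x y hxy hx => by
        have := hxy n (by omega)
        simp only [mem_ofPred_eq] at hx ⊢
        rwa [← this])
    · have h1 : secCount n {x : ∀ n, V n | x n ∈ range (j n)} z ≤ k n := by
        unfold secCount
        rw [← Set.ncard_coe_finset]
        calc _ ≤ (range (j n)).ncard := by
              refine Set.ncard_le_ncard_of_injOn (fun v => v + z n) ?_ ?_ (Set.toFinite _)
              · intro v hv
                simpa using hv
              · intro v _ v' _ h
                simpa using h
          _ ≤ k n := by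
              rw [← Set.image_univ]
              refine (Set.ncard_image_le (Set.toFinite _)).trans ?_
              simp
      have h2 : (k n : ℝ) * 2 ^ n ≤ Fintype.card (V n) := by exact_mod_cast hkV n
      have h3 : (secCount n {x : ∀ n, V n | x n ∈ range (j n)} z : ℝ) ≤ k n := by exact_mod_cast h1
      refine h3.trans ?_
      rw [one_div, inv_pow, inv_mul_eq_div, le_div_iff₀ (by positivity)]
      exact h2
  refine ne_top_of_le_ne_top ?_ (ENNReal.tsum_le_tsum hb)
  rw [← ENNReal.ofReal_tsum_of_nonneg (fun J => by positivity) summable_geometric_two]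
  exact ENNReal.ofReal_ne_top
end Assembly

section Final
open Filter

lemma CH_zero (CH : Cardinal.continuum = Cardinal.aleph 1) :
    Cardinal.continuum.{0} = Cardinal.aleph 1 := by
  apply Cardinal.lift_injective
  rw [Cardinal.lift_continuum, Cardinal.lift_aleph]
  simpa using CH

lemma final_aux (CH : Cardinal.continuum.{0} = Cardinal.aleph 1) :
    ∃ X₁ X₂ : Set Cantor, StronglyMeager X₁ ∧ StronglyMeager X₂ ∧
      ¬ StronglyMeager (X₁ ∪ X₂) := by
  classical
  choose d k j M hd hk hkV hmix hMV hM0 using exists_mixing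
  have : Infinite (Σ n, Fin (d n)) :=
    Infinite.of_injective (fun n => (⟨n, ⟨0, hd n⟩⟩ : Σ n, Fin (d n)))
      fun a b h => congrArg Sigma.fst h
  obtain ⟨e⟩ : Nonempty (ℕ ≃ Σ n, Fin (d n)) := nonempty_equiv_of_countable
  let V : ℕ → Type := fun n => Fin (d n) → ZMod 2
  let φ : Cantor → (∀ n, V n) := fun x n i => x (e.symm ⟨n, i⟩)
  let ψ : (∀ n, V n) → Cantor := fun y m => y (e m).1 (e m).2
  have hψφ : ∀ x, ψ (φ x) = x := fun x => by funext m; simp [ψ, φ]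
  have hφψ : ∀ y, φ (ψ y) = y := fun y => by
    funext n i
    simp only [ψ, φ]
    rw [e.apply_symm_apply]
  have hφadd : ∀ x y, φ (x + y) = φ x + φ y := fun x y => rfl
  have hψadd : ∀ x y, ψ (x + y) = ψ x + ψ y := fun x y => rfl
  have hφc : Continuous φ := by fun_prop
  have hψc : Continuous ψ := by
    refine continuous_pi fun m => ?_
    exact (continuous_apply (e m).2).comp (continuous_apply (e m).1)
  let Φ : Cantor ≃ₜ (∀ n, V n) := ⟨⟨φ, ψ, hψφ, hφψ⟩, hφc, hψc⟩
  have hμ : IsProbabilityMeasure μ := ⟨by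
    unfold μ
    exact Measure.addHaarMeasure_self⟩
  have hμi : μ.IsAddLeftInvariant := by unfold μ; infer_instance
  let ν : Measure (∀ n, V n) := μ.map φ
  have hν : IsProbabilityMeasure ν := Measure.isProbabilityMeasure_map hφc.measurable.aemeasurable
  have hνapp : ∀ A, ν A = μ (φ ⁻¹' A) := fun A => Φ.toMeasurableEquiv.map_apply A
  have hνi : ν.IsAddLeftInvariant := by
    refine ⟨fun g => ?_⟩
    ext A hA
    rw [Measure.map_apply (measurable_const_add g) hA, hνapp, hνapp]
    have : φ ⁻¹' ((fun x => g + x) ⁻¹' A) = (fun x => ψ g + x) ⁻¹' (φ ⁻¹' A) := by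
      ext x
      simp [hφadd, hφψ]
    rw [this, measure_preimage_add]
  have hcard : ∀ n, Fintype.card (V n) = 2 ^ d n := fun n => by simp [V]
  obtain ⟨Y, hY1, hY2⟩ := exists_sets (V := V) (j := j) CH ν hk hmix hM0 (fun n => by
    rw [hcard]; exact_mod_cast hMV n)
  have hnull := null_hits (V := V) (j := j) ν (fun n => by rw [hcard]; exact hkV n)
  have hneg : ∀ x : Cantor, -x = x := fun x => by funext n; exact ZMod.neg_eq_self_mod_two _
  have hSM : ∀ i, StronglyMeager (φ ⁻¹' (Y i)) := by
    intro i G hG hcon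
    obtain ⟨u, hu⟩ := hY1 i (ψ ⁻¹' G) (by
      rw [hνapp]
      convert hG using 2
      ext x; simp [hψφ])
    have hmem : ψ u ∈ φ ⁻¹' (Y i) + G := by rw [hcon]; trivial
    obtain ⟨x, hx, g, hg, hxg⟩ := Set.mem_add.mp hmem
    apply hu (φ x) hx
    change ψ (φ x + u) ∈ G
    rw [hψadd, hψφ, ← hxg, ← add_assoc]
    nth_rewrite 1 [← hneg x]
    rw [neg_add_cancel, zero_add]
    exact hg
  refine ⟨φ ⁻¹' (Y false), φ ⁻¹' (Y true), hSM _, hSM _, fun hcon => ?_⟩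
  refine hcon (φ ⁻¹' {x | ∃ᶠ n in atTop, x n ∈ range (j n)}) (by rw [← hνapp]; exact hnull) ?_
  refine eq_univ_of_forall fun z => ?_
  obtain ⟨i, x, hx, hxz⟩ := hY2 (φ z)
  refine Set.mem_add.mpr ⟨ψ x, ?_, ψ x - z, ?_, ?_⟩
  · have : φ (ψ x) ∈ Y i := by rw [hφψ]; exact hx
    cases i
    · exact Or.inl this
    · exact Or.inr this
  · have h : φ (ψ x - z) = x - φ z := by
      have : φ (ψ x - z) = φ (ψ x) - φ z := rfl
      rw [this, hφψ]
    change ∃ᶠ n in atTop, φ (ψ x - z) n ∈ range (j n)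
    rw [h]; exact hxz
  · rw [sub_eq_add_neg, hneg z, ← add_assoc]
    nth_rewrite 1 [← hneg (ψ x)]
    rw [neg_add_cancel, zero_add]
end Final

/-- Theorem 2.3 of the paper: assuming CH, from a family `P ⊆ Perf × Perf` with the
fusion property (witnessed by relations `R n`) satisfying conditions (A1) and (A2)
one obtains two strongly meager sets whose union is not strongly meager. -/
theorem stronglyMeager_not_ideal_of_fusion_poset
    (CH : Cardinal.continuum = Cardinal.aleph 1)
    (H : Set Cantor) (hH : μ H = 0)
    (P : Set (Perf × Perf))
    (R : ℕ → Perf × Perf → Perf × Perf → Prop)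
    -- `R n p q` (i.e. `p ≥ₙ q`) implies `p ≥ q`, i.e. `p₁ ⊆ q₁` and `p₂ ⊆ q₂`
    (hR_le : ∀ (n : ℕ), ∀ p ∈ P, ∀ q ∈ P, R n p q →
      p.1.1 ⊆ q.1.1 ∧ p.2.1 ⊆ q.2.1)
    -- if `p ≥_{n+1} q` and `r ≥_{n+1} p` then `r ≥ₙ q`
    (hR_trans : ∀ (n : ℕ), ∀ p ∈ P, ∀ q ∈ P, ∀ r ∈ P,
      R (n + 1) p q → R (n + 1) r p → R n r q)
    -- fusion: every sequence with `p_{n+1} ≥_{n+1} pₙ` has an upper bound `p_ω ≥ₙ pₙ`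
    (hR_fusion : ∀ p : ℕ → Perf × Perf, (∀ n, p n ∈ P) →
      (∀ n, R (n + 1) (p (n + 1)) (p n)) →
      ∃ pω ∈ P, ∀ n, R n pω (p n))
    -- (A1)
    (hA1 : ∀ p ∈ P, ∀ (n : ℕ) (z : Cantor), ∃ q ∈ P, R n q p ∧
      (q.1.1 ⊆ H + {z} ∨ q.2.1 ⊆ H + {z}))
    -- (A2)
    (hA2 : ∀ p ∈ P, ∀ (n : ℕ), ∀ X : Set Cantor, X.Countable →
      ∀ pick : Perf × Perf → Perf, (pick = Prod.fst ∨ pick = Prod.snd) →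
      ∀ t : Set Cantor, Perfect t → t.Nonempty → 0 < μ t →
      μ ({z : Cantor | ∃ q ∈ P, R n q p ∧
            X ∪ ((pick q).1 + Qfin) ⊆ t + Qfin + {z}}ᶜ) = 0) :
    ∃ X₁ X₂ : Set Cantor, StronglyMeager X₁ ∧ StronglyMeager X₂ ∧
      ¬ StronglyMeager (X₁ ∪ X₂) := by
  exact final_aux (CH_zero CH)
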